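/- Suppose g ∈ H^1, the continuous function on 𝕌 with Fourier coefficients g is nonvanishing (min_{z∈𝕌}|g(z)| > 0), and the singular integral equation 𝒞⁺u − (𝒞⁻u)·g = g − 1 has a unique solution u ∈ L², which moreover lies in H^1. Then the Toeplitz operator 𝒯(g) = 𝒞⁺𝓜(g)𝒞⁺ is boundedly invertible on ran 𝒞⁺, and there exists N₀ > 0 such that for every N > N₀ the finite section 𝓜_N(g) = 𝒫_N𝓜(g)𝒫_N is invertible on ran 𝒫_N, with sup_{N>N₀}‖𝓜_N(g)^{−1}‖_{L²→L²} < ∞. -/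

import Mathlib

noncomputable section

open scoped BigOperators

/-- The Sobolev weight `max(1,|j|)`. -/
def wt (j : ℤ) : ℝ := max 1 |(j : ℝ)|

/-- Membership of a two-sided sequence in the Sobolev space `H^s`. -/
def hsumm (s : ℝ) (u : ℤ → ℂ) : Prop :=
  Summable fun j : ℤ => ‖u j‖ ^ 2 * wt j ^ (2 * s)

/-- The `H^s` norm of a two-sided sequence. -/
def hnorm (s : ℝ) (u : ℤ → ℂ) : ℝ :=
  Real.sqrt (∑' j : ℤ, ‖u j‖ ^ 2 * wt j ^ (2 * s))

/-- `N₋ = ⌊N/2⌋`. -/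
def Nmin (N : ℕ) : ℤ := (N : ℤ) / 2

/-- `N₊ = ⌊(N-1)/2⌋`. -/
def Npl (N : ℕ) : ℤ := ((N : ℤ) - 1) / 2

/-- The Fourier truncation projection `𝒫_N`. -/
def projP (N : ℕ) (u : ℤ → ℂ) : ℤ → ℂ :=
  fun j => if -Nmin N ≤ j ∧ j ≤ Npl N then u j else 0

/-- The trigonometric interpolation projection `𝓘_N` (via the aliasing formula). -/
def interpI (N : ℕ) (u : ℤ → ℂ) : ℤ → ℂ :=
  fun j => if -Nmin N ≤ j ∧ j ≤ Npl N then ∑' p : ℤ, u (p * (N : ℤ) + j) else 0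

/-- Membership in `ran 𝒫_N`. -/
def inPN (N : ℕ) (u : ℤ → ℂ) : Prop := projP N u = u

/-- The boundary value `𝒞⁺` of the Cauchy transform: keep the nonnegative modes. -/
def Cpl (u : ℤ → ℂ) : ℤ → ℂ := fun j => if 0 ≤ j then u j else 0

/-- The boundary value `𝒞⁻` of the Cauchy transform: `-1` times the negative modes. -/
def Cmn (u : ℤ → ℂ) : ℤ → ℂ := fun j => if j < 0 then -u j else 0

/-- Multiplication of functions on `𝕌`, i.e. convolution of Fourier coefficients:
`𝓜(g)u = g·u`. -/
def cmul (g u : ℤ → ℂ) : ℤ → ℂ := fun n => ∑' j : ℤ, g (n - j) * u j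

/-- The Fourier coefficients of the constant function `1`. -/
def one1 : ℤ → ℂ := fun j => if j = 0 then 1 else 0
/-- The continuous function on `𝕌` with Fourier coefficients `g` is nonvanishing:
`min_{z ∈ 𝕌} |g(z)| > 0`. -/
def nonvanishing (g : ℤ → ℂ) : Prop :=
  ∃ ε : ℝ, 0 < ε ∧ ∀ θ : ℝ,
    ε ≤ ‖∑' j : ℤ, g j * Complex.exp (Complex.I * (j : ℂ) * (θ : ℂ))‖

/-- The Toeplitz operator `𝒯(g) = 𝒞⁺ 𝓜(g) 𝒞⁺`. -/
def Topl (g u : ℤ → ℂ) : ℤ → ℂ := Cpl (cmul g (Cpl u))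

theorem exists_inverse_powerSeries {A : Type*} [NormedRing A] [NormedAlgebra ℂ A] [CompleteSpace A]
    [NormOneClass A] (v : A) (hv : ‖v‖ ≤ 1) (c : ℕ → ℂ) (hc : Summable fun n => ‖c n‖)
    (h : ∀ z : ℂ, ‖z‖ ≤ 1 → ∑' n, c n * z ^ n ≠ 0) :
    ∃ y ∈ Algebra.elemental ℂ v,
      y * ∑' n, c n • v ^ n = 1 ∧ (∑' n, c n • v ^ n) * y = 1 := by
  let E := Algebra.elemental ℂ v
  let _ : NormedCommRing E :=
    { (inferInstance : NormedRing E) with mul_comm := fun a b => mul_comm a b }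
  let w : E := ⟨v, Algebra.elemental.self_mem ℂ v⟩
  have hw : ‖w‖ ≤ 1 := hv
  have hE : NormOneClass E := ⟨norm_one (α := A)⟩
  have hs : Summable fun n => c n • w ^ n := by
    refine Summable.of_norm_bounded hc fun n => ?_
    rw [norm_smul]
    exact mul_le_of_le_one_right (norm_nonneg _)
      ((norm_pow_le w n).trans (pow_le_one₀ (norm_nonneg _) hw))
  have hu : IsUnit (∑' n, c n • w ^ n) := by
    by_contra hnu
    obtain ⟨φ, hφ⟩ := WeakDual.CharacterSpace.exists_apply_eq_zero hnu
    have hz : ‖φ w‖ ≤ 1 :=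
      (spectrum.norm_le_norm_of_mem (AlgHom.apply_mem_spectrum φ w)).trans hw
    refine h (φ w) hz ?_
    have := (hs.hasSum.map φ (map_continuous φ)).tsum_eq
    rw [hφ] at this
    rw [← this]
    exact tsum_congr fun n => by simp
  obtain ⟨U, hU⟩ := hu
  have hcoe : ((∑' n, c n • w ^ n : E) : A) = ∑' n, c n • v ^ n := by
    have := (hs.hasSum.map E.val continuous_subtype_val).tsum_eq
    exact this.symm.trans (tsum_congr fun n => rfl)
  refine ⟨(U⁻¹ : Eˣ).1, (U⁻¹ : Eˣ).1.2, ?_, ?_⟩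
  · rw [← hcoe, ← hU]
    exact congrArg Subtype.val U.inv_mul
  · rw [← hcoe, ← hU]
    exact congrArg Subtype.val U.mul_inv

theorem exists_norm_pow_mul_commutator_le {A : Type*} [NormedRing A] [NormedAlgebra ℂ A]
    {V L X Y : A} (hLV : L * V = 1) (hL : ‖L‖ ≤ 1) [NormOneClass A]
    (hX : Commute L X) (hY : Y ∈ Algebra.elemental ℂ V) {ε : ℝ} (hε : 0 < ε) :
    ∃ n₀ : ℕ, ∀ n, n₀ ≤ n → ‖L ^ n * (Y * X - X * Y)‖ ≤ ε := by
  have key : ∀ p : Polynomial ℂ, ∃ n₀ : ℕ, ∀ n, n₀ ≤ n →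
      L ^ n * (Polynomial.aeval V p * X - X * Polynomial.aeval V p) = 0 := by
    intro p
    induction p using Polynomial.induction_on' with
    | add p q hp hq =>
      obtain ⟨a, ha⟩ := hp
      obtain ⟨b, hb⟩ := hq
      refine ⟨max a b, fun n hn => ?_⟩
      have h1 := ha n (le_trans (le_max_left _ _) hn)
      have h2 := hb n (le_trans (le_max_right _ _) hn)
      rw [map_add, add_mul, mul_add, add_sub_add_comm, mul_add, h1, h2, add_zero]
    | monomial k a =>
      refine ⟨k, fun n hn => ?_⟩
      obtain ⟨m, rfl⟩ := Nat.exists_eq_add_of_le' hn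
      have hk : L ^ k * V ^ k = 1 := pow_mul_pow_eq_one k hLV
      have h1 : L ^ (m + k) * V ^ k = L ^ m := by rw [pow_add, mul_assoc, hk, mul_one]
      have h2 := (hX.pow_left (m + k)).eq
      have h3 := (hX.pow_left m).eq
      rw [Polynomial.aeval_monomial, ← Algebra.smul_def, smul_mul_assoc, mul_smul_comm,
        ← smul_sub, mul_smul_comm, mul_sub, ← mul_assoc, h1, ← mul_assoc, h2, mul_assoc, h1, h3,
        sub_self, smul_zero]
  have hδ : 0 < ε / (2 * (‖X‖ + 1)) := by positivity
  have hY' : Y ∈ closure (Algebra.adjoin ℂ {V} : Set A) := hY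
  obtain ⟨Z, hZ, hd⟩ := Metric.mem_closure_iff.1 hY' _ hδ
  rw [SetLike.mem_coe, Algebra.adjoin_singleton_eq_range_aeval] at hZ
  obtain ⟨p, rfl⟩ := hZ
  obtain ⟨n₀, hn₀⟩ := key p
  refine ⟨n₀, fun n hn => ?_⟩
  have h0 := hn₀ n hn
  set Z : A := Polynomial.aeval V p
  have e : L ^ n * (Y * X - X * Y) = L ^ n * ((Y - Z) * X - X * (Y - Z)) := by
    rw [← sub_eq_zero, ← mul_sub, ← h0]
    congr 1
    noncomm_ring
  rw [dist_eq_norm, lt_div_iff₀ (by positivity)] at hd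
  have hLn : ‖L ^ n‖ ≤ 1 := (norm_pow_le L n).trans (pow_le_one₀ (norm_nonneg _) hL)
  calc ‖L ^ n * (Y * X - X * Y)‖ ≤ ‖L ^ n‖ * ‖(Y - Z) * X - X * (Y - Z)‖ := by
        rw [e]; exact norm_mul_le _ _
    _ ≤ 1 * (‖Y - Z‖ * ‖X‖ + ‖X‖ * ‖Y - Z‖) := by
        gcongr
        exact (norm_sub_le _ _).trans (add_le_add (norm_mul_le _ _) (norm_mul_le _ _))
    _ ≤ ε := by
        change ‖Y - Z‖ * _ < ε at hd
        nlinarith [norm_nonneg (Y - Z)]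

/-- Stability of finite sections for an operator `A` with a Wiener–Hopf factorization
`A = B₋⁻¹ B₊`, where `B₊⁻¹` is a limit of polynomials in `V` and `B₋` commutes with the left
inverse `L` of `V`. -/
theorem exists_finite_section_bound {H : Type*} [NormedAddCommGroup H] [NormedSpace ℂ H]
    [Nontrivial H] {V L A Bp Bm Cp Cm : H →L[ℂ] H} (hLV : L * V = 1) (hL : ‖L‖ ≤ 1)
    (hV : ‖V‖ ≤ 1) (hA : Bm * A = Bp) (hp1 : Cp * Bp = 1)
    (hp2 : Bp * Cp = 1) (hm1 : Cm * Bm = 1) (hCp : Cp ∈ Algebra.elemental ℂ V)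
    (hBm : Commute L Bm) :
    ∃ (n₀ : ℕ) (c : ℝ), ∀ n, n₀ ≤ n → ∀ x : H, (L ^ n) x = 0 →
      ‖x‖ ≤ c * ‖A x - (V ^ n) ((L ^ n) (A x))‖ := by
  set M := ‖Bp * Cm‖ + 1 with hM
  have hMpos : 0 < M := by positivity
  obtain ⟨n₀, hn₀⟩ := exists_norm_pow_mul_commutator_le hLV hL hBm hCp
    (ε := 1 / (2 * M)) (by positivity)
  have hVC : Commute V Cp :=
    (Algebra.elemental.le_centralizer_centralizer ℂ V hCp V (by
      rw [SetLike.mem_coe, Subalgebra.mem_centralizer_iff]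
      rintro _ rfl
      rfl))
  set K := ‖Cp * Bm‖
  refine ⟨n₀, K * (1 + 2 * M * K), fun n hn x hx => ?_⟩
  set f := A x - (V ^ n) ((L ^ n) (A x)) with hf
  set p := (L ^ n) (A x) with hp
  have hLVn : L ^ n * V ^ n = 1 := pow_mul_pow_eq_one n hLV
  have hx1 : x = (Cp * Bm) f + (Cp * Bm) ((V ^ n) p) := by
    rw [← map_add, hf, sub_add_cancel]
    have : Cp * Bm * A = 1 := by rw [mul_assoc, hA, hp1]
    exact (congrArg (fun T : H →L[ℂ] H => T x) this).symm
  have hLn : ‖L ^ n‖ ≤ 1 := (norm_pow_le L n).trans (pow_le_one₀ (norm_nonneg _) hL)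
  have hVn : ‖V ^ n‖ ≤ 1 := (norm_pow_le V n).trans (pow_le_one₀ (norm_nonneg _) hV)
  have hop : L ^ n * (Cp * Bm) * V ^ n = L ^ n * (Cp * Bm - Bm * Cp) * V ^ n + Bm * Cp := by
    have : L ^ n * (Bm * Cp) * V ^ n = Bm * Cp := by
      rw [← mul_assoc, (hBm.pow_left n).eq, mul_assoc, mul_assoc, ← (hVC.pow_left n).eq,
        ← mul_assoc (L ^ n), hLVn, one_mul]
    rw [mul_sub, sub_mul, this, sub_add_cancel]
  set D := L ^ n * (Cp * Bm - Bm * Cp) * V ^ n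
  have hD : ‖D‖ ≤ 1 / (2 * M) :=
    (norm_mul_le _ _).trans ((mul_le_of_le_one_right (norm_nonneg _) hVn).trans (hn₀ n hn))
  have h0 : (Bm * Cp) p = -((L ^ n) ((Cp * Bm) f)) - D p := by
    have h1 := congrArg (fun T : H →L[ℂ] H => T p) hop
    have h2 := congrArg (L ^ n) hx1
    rw [hx, map_add] at h2
    have h3 : (L ^ n) ((Cp * Bm) ((V ^ n) p)) = D p + (Bm * Cp) p := h1
    rw [h3] at h2
    rw [eq_sub_iff_add_eq, eq_neg_iff_add_eq_zero, h2]
    abel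
  have hpb : ‖p‖ ≤ M * ‖(Bm * Cp) p‖ := by
    have hcc : (Bp * Cm) * (Bm * Cp) = 1 := by
      rw [mul_assoc, ← mul_assoc Cm, hm1, one_mul, hp2]
    calc ‖p‖ = ‖(Bp * Cm) ((Bm * Cp) p)‖ :=
          congrArg norm (congrArg (fun T : H →L[ℂ] H => T p) hcc).symm
      _ ≤ ‖Bp * Cm‖ * ‖(Bm * Cp) p‖ := ContinuousLinearMap.le_opNorm _ _
      _ ≤ M * ‖(Bm * Cp) p‖ := by gcongr; linarith
  have hCf : ‖(Cp * Bm) f‖ ≤ K * ‖f‖ := ContinuousLinearMap.le_opNorm _ _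
  have h1 : ‖(Bm * Cp) p‖ ≤ K * ‖f‖ + 1 / (2 * M) * ‖p‖ := by
    rw [h0]
    refine (norm_sub_le _ _).trans (add_le_add ?_ ?_)
    · rw [norm_neg]
      refine (ContinuousLinearMap.le_opNorm _ _).trans ?_
      exact (mul_le_of_le_one_left (norm_nonneg _) hLn).trans hCf
    · exact (ContinuousLinearMap.le_opNorm _ _).trans (by gcongr)
  have hp2 : ‖p‖ ≤ 2 * M * K * ‖f‖ := by
    have h2 : M * ‖(Bm * Cp) p‖ ≤ M * (K * ‖f‖ + 1 / (2 * M) * ‖p‖) := by gcongr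
    have h3 : M * (K * ‖f‖ + 1 / (2 * M) * ‖p‖) = M * K * ‖f‖ + ‖p‖ / 2 := by
      field_simp
    linarith
  have hVp : ‖(V ^ n) p‖ ≤ ‖p‖ :=
    (ContinuousLinearMap.le_opNorm _ _).trans (mul_le_of_le_one_left (norm_nonneg _) hVn)
  have hK : 0 ≤ K := norm_nonneg _
  calc ‖x‖ = ‖(Cp * Bm) f + (Cp * Bm) ((V ^ n) p)‖ := congrArg norm hx1
    _ ≤ K * ‖f‖ + K * ‖(V ^ n) p‖ :=
        (norm_add_le _ _).trans (add_le_add hCf (ContinuousLinearMap.le_opNorm _ _))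
    _ ≤ K * ‖f‖ + K * (2 * M * K * ‖f‖) := by gcongr; exact hVp.trans hp2
    _ = K * (1 + 2 * M * K) * ‖f‖ := by ring

theorem hsumm_zero_iff {u : ℤ → ℂ} : hsumm 0 u ↔ Summable fun j => ‖u j‖ ^ 2 := by
  simp [hsumm]

theorem hsumm_one_iff {u : ℤ → ℂ} : hsumm 1 u ↔ Summable fun j => ‖u j‖ ^ 2 * wt j ^ 2 := by
  simp only [hsumm, mul_one]
  norm_cast

theorem one_le_wt (j : ℤ) : 1 ≤ wt j := le_max_left _ _

theorem hsumm.of_norm_le {s : ℝ} {u v : ℤ → ℂ} (hv : hsumm s v) (h : ∀ j, ‖u j‖ ≤ ‖v j‖) :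
    hsumm s u := by
  refine Summable.of_nonneg_of_le (fun j => ?_) (fun j => ?_) hv
  · have := one_le_wt j; positivity
  · have := one_le_wt j
    have := h j
    gcongr

theorem hsumm.add {s : ℝ} {u v : ℤ → ℂ} (hu : hsumm s u) (hv : hsumm s v) : hsumm s (u + v) := by
  refine Summable.of_nonneg_of_le (fun j => ?_) (fun j => ?_) ((Summable.add hu hv).mul_left 2)
  · have := one_le_wt j; positivity
  · have h1 : 0 ≤ wt j ^ (2 * s) := by have := one_le_wt j; positivity
    have h2 : ‖(u + v) j‖ ^ 2 ≤ 2 * (‖u j‖ ^ 2 + ‖v j‖ ^ 2) := by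
      have h3 : ‖(u + v) j‖ ≤ ‖u j‖ + ‖v j‖ := norm_add_le _ _
      have h4 : ‖(u + v) j‖ ^ 2 ≤ (‖u j‖ + ‖v j‖) ^ 2 := by gcongr
      nlinarith [sq_nonneg (‖u j‖ - ‖v j‖)]
    nlinarith [mul_le_mul_of_nonneg_right h2 h1]

theorem hsumm_one1 (s : ℝ) : hsumm s one1 := by
  refine summable_of_ne_finset_zero (s := {0}) fun j hj => ?_
  simp only [Finset.mem_singleton] at hj
  simp [one1, hj]

theorem hsumm.summable_norm {u : ℤ → ℂ} (hu : hsumm 1 u) : Summable fun j => ‖u j‖ := by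
  have hw : Summable fun j : ℤ => (wt j ^ 2)⁻¹ := by
    refine Summable.of_norm_bounded_eventually (g := fun j : ℤ => 1 / (j : ℝ) ^ 2)
      (Real.summable_one_div_int_pow.2 one_lt_two) ?_
    filter_upwards [(Set.finite_singleton (0 : ℤ)).compl_mem_cofinite] with j hj
    have hj0 : (j : ℝ) ≠ 0 := by exact_mod_cast hj
    have h1 : (j : ℝ) ^ 2 ≤ wt j ^ 2 := by
      rw [← sq_abs]
      gcongr
      exact le_max_right _ _
    have h2 : 0 < (j : ℝ) ^ 2 := by positivity
    rw [Real.norm_of_nonneg (by positivity), one_div]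
    gcongr
  refine Summable.of_nonneg_of_le (fun j => norm_nonneg _) (fun j => ?_)
    ((hsumm_one_iff.1 hu).add hw)
  have hw1 := one_le_wt j
  have h3 : ‖u j‖ = (‖u j‖ * wt j) * (wt j)⁻¹ := by field_simp
  rw [← inv_pow, ← mul_pow]
  nlinarith [sq_nonneg (‖u j‖ * wt j - (wt j)⁻¹), sq_nonneg (‖u j‖ * wt j), sq_nonneg (wt j)⁻¹]

theorem bounded_of_summable_norm {a : ℤ → ℂ} (ha : Summable fun j => ‖a j‖) :
    ∃ C, ∀ j, ‖a j‖ ≤ C :=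
  ⟨_, fun j => ha.le_tsum j fun _ _ => norm_nonneg _⟩

theorem summable_mul_shift {k a : ℤ → ℂ} {C : ℝ} (hk : ∀ m, ‖k m‖ ≤ C)
    (ha : Summable fun j => ‖a j‖) (n : ℤ) : Summable fun j => k (n - j) * a j := by
  refine Summable.of_norm_bounded (ha.mul_left C) fun j => ?_
  rw [norm_mul]
  have := hk (n - j)
  gcongr

theorem cmul_add {k a b : ℤ → ℂ} (ha : ∀ n, Summable fun j => k (n - j) * a j)
    (hb : ∀ n, Summable fun j => k (n - j) * b j) :
    cmul k (a + b) = cmul k a + cmul k b := by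
  funext n
  simp only [cmul, Pi.add_apply, mul_add]
  exact (ha n).tsum_add (hb n)

theorem summable_prod_convolution {E : Type*} [NormedAddCommGroup E] [NormedSpace ℂ E]
    {a b : ℤ → ℂ} (ha : Summable fun j => ‖a j‖)
    (hb : Summable fun j => ‖b j‖) {F : ℤ × ℤ → E} {C : ℝ} (hF : ∀ n, ‖F n‖ ≤ C) :
    Summable fun p : ℤ × ℤ => ‖(a p.1 * b p.2) • F p‖ := by
  have h := (ha.mul_of_nonneg hb (fun _ => norm_nonneg _) fun _ => norm_nonneg _).mul_right C
  refine Summable.of_nonneg_of_le (fun _ => norm_nonneg _) (fun p => ?_) h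
  rw [norm_smul, norm_mul]
  have := hF p
  gcongr

/-- The shear `(n, j) ↦ (n - j, j)` of `ℤ × ℤ`. -/
def shearEquiv : ℤ × ℤ ≃ ℤ × ℤ where
  toFun p := (p.1 - p.2, p.2)
  invFun p := (p.1 + p.2, p.2)
  left_inv p := by simp
  right_inv p := by simp

theorem tsum_cmul_smul {E : Type*} [NormedAddCommGroup E] [NormedSpace ℂ E] [CompleteSpace E]
    {a b : ℤ → ℂ} (ha : Summable fun j => ‖a j‖)
    (hb : Summable fun j => ‖b j‖) {F : ℤ → E} {C : ℝ} (hF : ∀ n, ‖F n‖ ≤ C) :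
    ∑' n, cmul a b n • F n = ∑' p : ℤ × ℤ, (a p.1 * b p.2) • F (p.1 + p.2) := by
  obtain ⟨D, hD⟩ := bounded_of_summable_norm ha
  have hs := (summable_prod_convolution ha hb (F := fun p => F (p.1 + p.2))
    fun p => hF (p.1 + p.2)).of_norm
  have hs' := (shearEquiv.summable_iff).2 hs
  rw [← shearEquiv.tsum_eq]
  refine Eq.trans ?_ hs'.tsum_prod.symm
  refine tsum_congr fun n => ?_
  rw [cmul, ← (summable_mul_shift hD hb n).tsum_smul_const]
  exact tsum_congr fun j => by simp [shearEquiv]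

theorem summable_norm_cmul {a b : ℤ → ℂ} (ha : Summable fun j => ‖a j‖)
    (hb : Summable fun j => ‖b j‖) : Summable fun n => ‖cmul a b n‖ := by
  have hs := summable_prod_convolution ha hb (F := fun _ => (1 : ℂ)) (C := 1) (by simp)
  have hs' := (shearEquiv.summable_iff).2 hs
  refine Summable.of_nonneg_of_le (fun _ => norm_nonneg _) (fun n => ?_) hs'.prod
  refine (norm_tsum_le_tsum_norm ?_).trans_eq (tsum_congr fun j => by simp [shearEquiv])
  simpa [shearEquiv, Function.comp_def] using hs'.prod_factor n

theorem cmul_left_comm {g k b : ℤ → ℂ} (hg : Summable fun j => ‖g j‖)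
    (hb : Summable fun j => ‖b j‖) {C : ℝ} (hk : ∀ m, ‖k m‖ ≤ C) :
    cmul g (cmul k b) = cmul k (cmul g b) := by
  funext n
  have h1 := tsum_cmul_smul hg hb (F := fun j => k (n - j)) fun j => hk (n - j)
  have h2 : cmul k (cmul g b) n = ∑' j, cmul g b j • k (n - j) :=
    tsum_congr fun j => by rw [smul_eq_mul, mul_comm]
  have hs := (summable_prod_convolution hg hb (F := fun p => k (n - (p.1 + p.2)))
    fun p => hk (n - (p.1 + p.2))).of_norm
  rw [h2, h1, hs.tsum_prod, cmul, ← (Equiv.subLeft n).tsum_eq]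
  refine tsum_congr fun m => ?_
  simp only [Equiv.subLeft_apply, sub_sub_cancel, cmul, ← tsum_mul_left]
  exact tsum_congr fun i => by rw [smul_eq_mul, sub_add_eq_sub_sub]; ring

theorem norm_cmul_le_tsum {k a : ℤ → ℂ} {n : ℤ} (ha : Summable fun j => ‖a j‖)
    (hk : ∀ m, ‖k m‖ ≤ 1) {e : ℕ → ℤ} (he : Function.Injective e)
    (h : ∀ j, j ∉ Set.range e → k (n - j) * a j = 0) :
    ‖cmul k a n‖ ≤ ∑' i, ‖a (e i)‖ := by
  have h1 : cmul k a n = ∑' i, k (n - e i) * a (e i) :=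
    (he.tsum_eq (f := fun j => k (n - j) * a j) fun j hj => by
      by_contra hc
      exact hj (h j hc)).symm
  rw [h1]
  refine tsum_of_norm_bounded (ha.comp_injective he).hasSum fun i => ?_
  rw [norm_mul]
  exact mul_le_of_le_one_left (norm_nonneg _) (hk _)

/-- A discrete Hardy inequality for tails of sums. -/
theorem summable_sq_tail {x : ℕ → ℝ} (hx : Summable x)
    (h2 : Summable fun n : ℕ => ((n : ℝ) + 1) ^ 2 * x n ^ 2) :
    Summable fun n => (∑' i, x (i + n)) ^ 2 := by
  set T : ℕ → ℝ := fun n => ∑' i, x (i + n) with hT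
  have hrec : ∀ n, T n = x n + T (n + 1) := fun n => by
    have := ((summable_nat_add_iff n).2 hx).tsum_eq_zero_add
    simp only [zero_add] at this
    rw [hT]
    simp only [this]
    congr 1
    exact tsum_congr fun i => by rw [add_assoc, add_comm 1 n]
  have hlim : Filter.Tendsto T Filter.atTop (nhds 0) := tendsto_sum_nat_add x
  have hfin : ∀ (t : ℝ) (m : ℕ), ∑ n ∈ Finset.range m, (T n - t) ^ 2 / 2 ≤
      m * (T m - t) ^ 2 + 2 * ∑ n ∈ Finset.range m, ((n : ℝ) + 1) ^ 2 * x n ^ 2 := by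
    intro t m
    induction m with
    | zero => simp
    | succ m ih =>
      rw [Finset.sum_range_succ, Finset.sum_range_succ]
      have h1 : T (m + 1) = T m - x m := by rw [hrec m]; ring
      rw [h1]
      push_cast
      nlinarith [sq_nonneg ((T m - t) - 2 * ((m : ℝ) + 1) * x m),
        mul_nonneg (by positivity : (0 : ℝ) ≤ (m : ℝ) + 1) (sq_nonneg (x m))]
  set S := ∑' n : ℕ, ((n : ℝ) + 1) ^ 2 * x n ^ 2
  refine summable_of_sum_range_le (c := 4 * S) (fun n => sq_nonneg _) fun N => ?_
  have hle : ∀ M, N ≤ M → ∑ n ∈ Finset.range N, (T n - T M) ^ 2 ≤ 4 * S := by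
    intro M hM
    have h3 := hfin (T M) M
    rw [sub_self, ← Finset.sum_div] at h3
    have h4 : ∑ n ∈ Finset.range M, ((n : ℝ) + 1) ^ 2 * x n ^ 2 ≤ S :=
      h2.sum_le_tsum _ fun n _ => by positivity
    have h5 : ∑ n ∈ Finset.range N, (T n - T M) ^ 2 ≤ ∑ n ∈ Finset.range M, (T n - T M) ^ 2 :=
      Finset.sum_le_sum_of_subset_of_nonneg (Finset.range_mono hM) fun _ _ _ => sq_nonneg _
    nlinarith
  have hl : Filter.Tendsto (fun M => ∑ n ∈ Finset.range N, (T n - T M) ^ 2) Filter.atTop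
      (nhds (∑ n ∈ Finset.range N, (T n - 0) ^ 2)) :=
    tendsto_finsetSum _ fun n _ => (tendsto_const_nhds.sub hlim).pow 2
  simp only [sub_zero] at hl
  exact le_of_tendsto hl (Filter.eventually_atTop.2 ⟨N, hle⟩)

/-- The coefficients of `1 / (ζ - z)` expanded in negative powers of `ζ`. -/
def extKernel (z : ℂ) (m : ℤ) : ℂ := if m < 0 then z ^ (-1 - m).toNat else 0

/-- The coefficients of `1 / (1 - w ζ)` expanded in nonnegative powers of `ζ`. -/
def intKernel (w : ℂ) (m : ℤ) : ℂ := if 0 ≤ m then w ^ m.toNat else 0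

theorem norm_extKernel_le {z : ℂ} (hz : ‖z‖ ≤ 1) (m : ℤ) : ‖extKernel z m‖ ≤ 1 := by
  unfold extKernel
  split_ifs
  · rw [norm_pow]; exact pow_le_one₀ (norm_nonneg _) hz
  · simp

theorem norm_intKernel_le {w : ℂ} (hw : ‖w‖ ≤ 1) (m : ℤ) : ‖intKernel w m‖ ≤ 1 := by
  unfold intKernel
  split_ifs
  · rw [norm_pow]; exact pow_le_one₀ (norm_nonneg _) hw
  · simp

theorem summable_intKernel {w : ℂ} (hw : ‖w‖ < 1) : Summable fun m => ‖intKernel w m‖ := by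
  refine Summable.of_nat_of_neg_add_one ?_ ?_
  · simpa [intKernel] using summable_geometric_of_lt_one (norm_nonneg _) hw
  · refine summable_zero.congr fun n => ?_
    rw [intKernel, if_neg (by omega), norm_zero]

theorem summable_extKernel {z : ℂ} (hz : ‖z‖ < 1) : Summable fun m => ‖extKernel z m‖ := by
  refine Summable.of_nat_of_neg_add_one ?_ ?_
  · refine summable_zero.congr fun n => ?_
    rw [extKernel, if_neg (by omega), norm_zero]
  · refine (summable_geometric_of_lt_one (norm_nonneg _) hz).congr fun n => ?_
    rw [extKernel, if_pos (by omega), norm_pow]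
    congr 1
    omega

theorem Summable.norm_sq {ι : Type*} {a : ι → ℂ} (ha : Summable fun j => ‖a j‖) :
    Summable fun j => ‖a j‖ ^ 2 := by
  have hC : ∀ j, ‖a j‖ ≤ ∑' j, ‖a j‖ := fun j => ha.le_tsum j fun _ _ => norm_nonneg _
  refine Summable.of_nonneg_of_le (fun _ => sq_nonneg _) (fun j => ?_)
    (ha.mul_left (∑' j, ‖a j‖))
  rw [sq]
  exact mul_le_mul_of_nonneg_right (hC j) (norm_nonneg _)

theorem extKernel_cmul_neg_one {b : ℤ → ℂ} (hb0 : b 0 = 1) (hb : ∀ n, 0 < n → b n = 0) (z : ℂ) :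
    cmul (extKernel z) b (-1) = 1 := by
  rw [cmul, tsum_eq_single 0]
  · simp [extKernel, hb0]
  · intro j hj
    rcases lt_or_gt_of_ne hj with h | h
    · rw [extKernel, if_neg (by omega), zero_mul]
    · rw [hb j h, mul_zero]

theorem extKernel_cmul_of_nonneg {b : ℤ → ℂ} (hb : ∀ n, 0 < n → b n = 0) (z : ℂ) {n : ℤ}
    (hn : 0 ≤ n) : cmul (extKernel z) b n = 0 := by
  rw [cmul, ← tsum_zero (α := ℂ) (β := ℤ)]
  refine tsum_congr fun j => ?_
  rcases le_or_gt j 0 with h | h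
  · rw [extKernel, if_neg (by omega), zero_mul]
  · rw [hb j h, mul_zero]

theorem extKernel_cmul_of_neg {a : ℤ → ℂ} (ha : ∀ n, n < 0 → a n = 0) {z : ℂ}
    (hz : ∑' n : ℕ, a n * z ^ n = 0) {n : ℤ} (hn : n < 0) : cmul (extKernel z) a n = 0 := by
  rw [cmul, ← Nat.cast_injective.tsum_eq]
  · have : ∀ i : ℕ, extKernel z (n - i) * a i = z ^ (-1 - n).toNat * (a i * z ^ i) := fun i => by
      rw [extKernel, if_pos (by omega),
        show (-1 - (n - (i : ℤ))).toNat = (-1 - n).toNat + i by omega, pow_add]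
      ring
    simp only [this, tsum_mul_left, hz, mul_zero]
  · intro j hj
    by_contra hc
    refine hj ?_
    dsimp only
    rw [ha j, mul_zero]
    by_contra h
    exact hc ⟨j.toNat, by simp; omega⟩

theorem intKernel_cmul_of_neg {a : ℤ → ℂ} (ha : ∀ n, n < 0 → a n = 0) (w : ℂ) {n : ℤ}
    (hn : n < 0) : cmul (intKernel w) a n = 0 := by
  rw [cmul, ← tsum_zero (α := ℂ) (β := ℤ)]
  refine tsum_congr fun j => ?_
  rcases lt_or_ge j 0 with h | h
  · rw [ha j h, mul_zero]
  · rw [intKernel, if_neg (by omega), zero_mul]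

theorem intKernel_cmul_of_nonneg {b : ℤ → ℂ} (hb : ∀ n, 0 < n → b n = 0) {w : ℂ}
    (hw : ∑' n : ℕ, b (-n) * w ^ n = 0) {n : ℤ} (hn : 0 ≤ n) : cmul (intKernel w) b n = 0 := by
  have hinj : Function.Injective fun i : ℕ => -(i : ℤ) := fun i j h => by simpa using h
  rw [cmul, ← hinj.tsum_eq]
  · have : ∀ i : ℕ, intKernel w (n - -(i : ℤ)) * b (-i) = w ^ n.toNat * (b (-i) * w ^ i) :=
      fun i => by
        rw [intKernel, if_pos (by omega), show (n - -(i : ℤ)).toNat = n.toNat + i by omega, pow_add]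
        ring
    simp only [this, tsum_mul_left, hw, mul_zero]
  · intro j hj
    by_contra hc
    refine hj ?_
    dsimp only
    rw [hb j, mul_zero]
    by_contra h
    exact hc ⟨(-j).toNat, by simp; omega⟩

theorem intKernel_cmul_recurrence {b : ℤ → ℂ} (hb : Summable fun j => ‖b j‖) {w : ℂ}
    (hw : ‖w‖ ≤ 1) (n : ℤ) :
    cmul (intKernel w) b n = b n + w * cmul (intKernel w) b (n - 1) := by
  have hs := summable_mul_shift (norm_intKernel_le hw) hb
  have h0 : HasSum (fun j => if j = n then b j else 0) (b n) := by
    simpa using hasSum_ite_eq n (b n) |>.congr_fun fun j => by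
      split_ifs with h <;> simp [h]
  have h1 := h0.add ((hs (n - 1)).hasSum.mul_left w)
  refine (HasSum.tsum_eq ?_ : cmul (intKernel w) b n = _)
  refine h1.congr_fun fun j => ?_
  unfold intKernel
  by_cases h : j = n
  · subst h; simp
  · rcases lt_or_gt_of_ne h with h' | h'
    · rw [if_pos (by omega), if_neg h, if_pos (by omega),
        show (n - j).toNat = (n - 1 - j).toNat + 1 by omega, pow_succ]
      ring
    · rw [if_neg (by omega), if_neg h, if_neg (by omega)]
      ring

section NonVanishing

variable {g a b : ℤ → ℂ}

/-- Uniqueness for the homogeneous Riemann–Hilbert problem `g q = p` in `L²`. -/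
def TrivialHomogeneous (g : ℤ → ℂ) : Prop :=
  ∀ p q : ℤ → ℂ, (Summable fun j => ‖p j‖ ^ 2) → (Summable fun j => ‖q j‖ ^ 2) →
    (∀ n, n < 0 → p n = 0) → (∀ n, 0 ≤ n → q n = 0) → cmul g q = p → q = 0

theorem tsum_pow_ne_zero_of_lt (hg : Summable fun j => ‖g j‖) (ha1 : Summable fun j => ‖a j‖)
    (hb1 : Summable fun j => ‖b j‖) (ha : ∀ n, n < 0 → a n = 0) (hb : ∀ n, 0 < n → b n = 0)
    (hb0 : b 0 = 1) (hab : cmul g b = a) (hom : TrivialHomogeneous g) {z : ℂ} (hz : ‖z‖ < 1) :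
    ∑' n : ℕ, a n * z ^ n ≠ 0 := by
  intro h
  have h1 := hom (cmul (extKernel z) a) (cmul (extKernel z) b)
    (summable_norm_cmul (summable_extKernel hz) ha1).norm_sq
    (summable_norm_cmul (summable_extKernel hz) hb1).norm_sq
    (fun n hn => extKernel_cmul_of_neg ha h hn) (fun n hn => extKernel_cmul_of_nonneg hb z hn)
    (by rw [cmul_left_comm hg hb1 (norm_extKernel_le hz.le), hab])
  have h2 := extKernel_cmul_neg_one hb0 hb z
  rw [h1] at h2
  exact zero_ne_one h2

theorem tsum_neg_pow_ne_zero_of_lt (hg : Summable fun j => ‖g j‖)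
    (ha1 : Summable fun j => ‖a j‖)
    (hb1 : Summable fun j => ‖b j‖) (ha : ∀ n, n < 0 → a n = 0) (hb : ∀ n, 0 < n → b n = 0)
    (hb0 : b 0 = 1) (hab : cmul g b = a) (hom : TrivialHomogeneous g) {w : ℂ} (hw : ‖w‖ < 1) :
    ∑' n : ℕ, b (-n) * w ^ n ≠ 0 := by
  intro h
  have h1 := hom (cmul (intKernel w) a) (cmul (intKernel w) b)
    (summable_norm_cmul (summable_intKernel hw) ha1).norm_sq
    (summable_norm_cmul (summable_intKernel hw) hb1).norm_sq
    (fun n hn => intKernel_cmul_of_neg ha w hn) (fun n hn => intKernel_cmul_of_nonneg hb h hn)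
    (by rw [cmul_left_comm hg hb1 (norm_intKernel_le hw.le), hab])
  have h2 := intKernel_cmul_recurrence hb1 hw.le 0
  rw [h1, hb0] at h2
  simp at h2

theorem tsum_zpow_eq_tsum_pow (ha : ∀ n, n < 0 → a n = 0) (z : ℂ) :
    ∑' n : ℤ, a n * z ^ n = ∑' n : ℕ, a n * z ^ n := by
  rw [← Nat.cast_injective.tsum_eq]
  · simp
  · intro j hj
    by_contra hc
    refine hj ?_
    dsimp only
    rw [ha j, zero_mul]
    by_contra h
    exact hc ⟨j.toNat, by simp; omega⟩

theorem tsum_zpow_eq_tsum_neg_pow (hb : ∀ n, 0 < n → b n = 0) (z : ℂ) :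
    ∑' n : ℤ, b n * z ^ n = ∑' n : ℕ, b (-n) * z⁻¹ ^ n := by
  have hinj : Function.Injective fun i : ℕ => -(i : ℤ) := fun i j h => by simpa using h
  rw [← hinj.tsum_eq]
  · simp
  · intro j hj
    by_contra hc
    refine hj ?_
    dsimp only
    rw [hb j, zero_mul]
    by_contra h
    exact hc ⟨(-j).toNat, by simp; omega⟩

theorem extKernel_cmul_of_tsum_zpow_eq_zero (hb1 : Summable fun j => ‖b j‖) {z : ℂ}
    (hz : ‖z‖ = 1) (h : ∑' n : ℤ, b n * z ^ n = 0) (n : ℤ) :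
    cmul (extKernel z) b n = cmul (fun m => if 0 ≤ m then -z ^ (-1 - m) else 0) b n := by
  have hz0 : z ≠ 0 := by rintro rfl; simp at hz
  have hk : ∀ m : ℤ, ‖if 0 ≤ m then -z ^ (-1 - m) else 0‖ ≤ 1 := fun m => by
    split_ifs
    · simp [hz]
    · simp
  rw [← sub_eq_zero, cmul, cmul, ← (summable_mul_shift (norm_extKernel_le hz.le) hb1 n).tsum_sub
    (summable_mul_shift hk hb1 n)]
  have : ∀ j, extKernel z (n - j) * b j - (if 0 ≤ n - j then -z ^ (-1 - (n - j)) else 0) * b j =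
      z ^ (-1 - n) * (b j * z ^ j) := fun j => by
    have e : z ^ (-1 - (n - j)) = z ^ (-1 - n) * z ^ j := by
      rw [← zpow_add₀ hz0]; congr 1; ring
    unfold extKernel
    split_ifs with h1 h2 h2
    · omega
    · rw [← zpow_natCast, Int.toNat_of_nonneg (by omega), e]; ring
    · rw [e]; ring
    · omega
  simp only [this, tsum_mul_left, h, mul_zero]

theorem summable_weight_sq (ha : hsumm 1 a) {e : ℕ → ℤ} (he : Function.Injective e)
    (hle : ∀ n : ℕ, (n : ℝ) ≤ |(e n : ℝ)|) :
    Summable fun n : ℕ => ((n : ℝ) + 1) ^ 2 * ‖a (e n)‖ ^ 2 := by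
  refine Summable.of_nonneg_of_le (fun _ => by positivity) (fun n => ?_)
    (((hsumm_one_iff.1 ha).comp_injective he).mul_left 4)
  have h1 : (n : ℝ) + 1 ≤ 2 * wt (e n) := by
    have := one_le_wt (e n)
    have h2 : |(e n : ℝ)| ≤ wt (e n) := le_max_right _ _
    linarith [hle n]
  calc ((n : ℝ) + 1) ^ 2 * ‖a (e n)‖ ^ 2 ≤ (2 * wt (e n)) ^ 2 * ‖a (e n)‖ ^ 2 := by gcongr
    _ = _ := by simp only [Function.comp_apply]; ring

theorem summable_sq_extKernel_cmul (ha : hsumm 1 a) {z : ℂ} (hz : ‖z‖ = 1)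
    (h : ∑' n : ℤ, a n * z ^ n = 0) : Summable fun n => ‖cmul (extKernel z) a n‖ ^ 2 := by
  have ha1 := ha.summable_norm
  refine Summable.of_nat_of_neg_add_one ?_ ?_
  · have hinj : Function.Injective fun i : ℕ => (i : ℤ) := Nat.cast_injective
    refine Summable.of_nonneg_of_le (fun _ => sq_nonneg _) (fun n => ?_)
      (summable_sq_tail (ha1.comp_injective hinj) (summable_weight_sq ha hinj fun n => by simp))
    gcongr
    refine norm_cmul_le_tsum ha1 (norm_extKernel_le hz.le) (e := fun i : ℕ => ((i + n : ℕ) : ℤ))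
      (fun i j h => by simpa using h) fun j hj => ?_
    rw [extKernel, if_neg, zero_mul]
    intro hlt
    exact hj ⟨(j - n).toNat, by simp; omega⟩
  · have hinj : Function.Injective fun i : ℕ => -((i : ℤ) + 1) := fun i j h => by
      simpa using h
    refine Summable.of_nonneg_of_le (fun _ => sq_nonneg _) (fun n => ?_)
      (summable_sq_tail (ha1.comp_injective hinj) (summable_weight_sq ha hinj fun n => ?_))
    · gcongr
      rw [extKernel_cmul_of_tsum_zpow_eq_zero ha1 hz h]
      refine norm_cmul_le_tsum ha1 (fun m => ?_) (e := fun i : ℕ => -(((i + n : ℕ) : ℤ) + 1))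
        (fun i j h => by simpa using h) fun j hj => ?_
      · split_ifs
        · simp [hz]
        · simp
      · rw [if_neg, zero_mul]
        intro hlt
        exact hj ⟨(-(n + 1) - j).toNat, by simp; omega⟩
    · push_cast
      rw [abs_neg, abs_of_nonneg (by positivity)]
      linarith

theorem not_tsum_zpow_eq_zero (hg : Summable fun j => ‖g j‖) (ha1 : hsumm 1 a)
    (hb1 : hsumm 1 b) (ha : ∀ n, n < 0 → a n = 0) (hb : ∀ n, 0 < n → b n = 0)
    (hb0 : b 0 = 1) (hab : cmul g b = a) (hom : TrivialHomogeneous g) {z : ℂ} (hz : ‖z‖ = 1)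
    (hza : ∑' n : ℤ, a n * z ^ n = 0) (hzb : ∑' n : ℤ, b n * z ^ n = 0) : False := by
  have h1 := hom (cmul (extKernel z) a) (cmul (extKernel z) b)
    (summable_sq_extKernel_cmul ha1 hz hza) (summable_sq_extKernel_cmul hb1 hz hzb)
    (fun n hn => extKernel_cmul_of_neg ha (tsum_zpow_eq_tsum_pow ha z ▸ hza) hn)
    (fun n hn => extKernel_cmul_of_nonneg hb z hn)
    (by rw [cmul_left_comm hg hb1.summable_norm (norm_extKernel_le hz.le), hab])
  have h2 := extKernel_cmul_neg_one hb0 hb z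
  rw [h1] at h2
  exact zero_ne_one h2

theorem tsum_cmul_zpow (hg : Summable fun j => ‖g j‖) (hb : Summable fun j => ‖b j‖) {z : ℂ}
    (hz : ‖z‖ = 1) :
    ∑' n : ℤ, cmul g b n * z ^ n = (∑' n : ℤ, g n * z ^ n) * ∑' n : ℤ, b n * z ^ n := by
  have hz0 : z ≠ 0 := by rintro rfl; simp at hz
  have hF : ∀ n : ℤ, ‖z ^ n‖ ≤ 1 := fun n => by simp [hz]
  have h := tsum_cmul_smul hg hb hF
  simp only [smul_eq_mul] at h
  have hn : ∀ c : ℤ → ℂ, (Summable fun j => ‖c j‖) → Summable fun j => ‖c j * z ^ j‖ :=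
    fun c hc => by simpa [hz] using hc
  rw [h, tsum_mul_tsum_of_summable_norm (hn g hg) (hn b hb)]
  exact tsum_congr fun p => by rw [zpow_add₀ hz0]; ring

theorem nonvanishing.tsum_zpow_ne_zero (hnv : nonvanishing g) {z : ℂ} (hz : ‖z‖ = 1) :
    ∑' n : ℤ, g n * z ^ n ≠ 0 := by
  obtain ⟨ε, hε, h⟩ := hnv
  have hθ := h z.arg
  have hz' : Complex.exp (Complex.I * z.arg) = z := by
    have := Complex.norm_mul_exp_arg_mul_I z
    rwa [hz, Complex.ofReal_one, one_mul, mul_comm] at this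
  intro h0
  have e : ∀ j : ℤ, Complex.exp (Complex.I * j * z.arg) = z ^ j := fun j => by
    rw [← hz', ← Complex.exp_int_mul, hz']
    congr 1; ring
  simp only [e, h0, norm_zero] at hθ
  exact absurd hθ (not_le.2 hε)

theorem tsum_zpow_ne_zero (hg : Summable fun j => ‖g j‖) (ha1 : hsumm 1 a)
    (hb1 : hsumm 1 b) (ha : ∀ n, n < 0 → a n = 0) (hb : ∀ n, 0 < n → b n = 0)
    (hb0 : b 0 = 1) (hab : cmul g b = a) (hom : TrivialHomogeneous g) (hnv : nonvanishing g)
    {z : ℂ} (hz : ‖z‖ = 1) :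
    ∑' n : ℤ, a n * z ^ n ≠ 0 ∧ ∑' n : ℤ, b n * z ^ n ≠ 0 := by
  have h := tsum_cmul_zpow hg hb1.summable_norm hz
  rw [hab] at h
  have hg0 := hnv.tsum_zpow_ne_zero hz
  have hb' : ∑' n : ℤ, b n * z ^ n ≠ 0 := fun h0 =>
    not_tsum_zpow_eq_zero hg ha1 hb1 ha hb hb0 hab hom hz (by rw [h, h0, mul_zero]) h0
  exact ⟨h ▸ mul_ne_zero hg0 hb', hb'⟩

theorem tsum_pow_ne_zero (hg : Summable fun j => ‖g j‖) (ha1 : hsumm 1 a)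
    (hb1 : hsumm 1 b) (ha : ∀ n, n < 0 → a n = 0) (hb : ∀ n, 0 < n → b n = 0)
    (hb0 : b 0 = 1) (hab : cmul g b = a) (hom : TrivialHomogeneous g) (hnv : nonvanishing g)
    {z : ℂ} (hz : ‖z‖ ≤ 1) : ∑' n : ℕ, a n * z ^ n ≠ 0 := by
  rcases hz.lt_or_eq with h | h
  · exact tsum_pow_ne_zero_of_lt hg ha1.summable_norm hb1.summable_norm ha hb hb0 hab hom h
  · rw [← tsum_zpow_eq_tsum_pow ha]
    exact (tsum_zpow_ne_zero hg ha1 hb1 ha hb hb0 hab hom hnv h).1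

theorem tsum_neg_pow_ne_zero (hg : Summable fun j => ‖g j‖) (ha1 : hsumm 1 a)
    (hb1 : hsumm 1 b) (ha : ∀ n, n < 0 → a n = 0) (hb : ∀ n, 0 < n → b n = 0)
    (hb0 : b 0 = 1) (hab : cmul g b = a) (hom : TrivialHomogeneous g) (hnv : nonvanishing g)
    {w : ℂ} (hw : ‖w‖ ≤ 1) : ∑' n : ℕ, b (-n) * w ^ n ≠ 0 := by
  rcases hw.lt_or_eq with h | h
  · exact tsum_neg_pow_ne_zero_of_lt hg ha1.summable_norm hb1.summable_norm ha hb hb0 hab hom h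
  · rw [← inv_inv w, ← tsum_zpow_eq_tsum_neg_pow hb]
    exact (tsum_zpow_ne_zero hg ha1 hb1 ha hb hb0 hab hom hnv (by simp [h])).2

end NonVanishing

/-- Square-summable sequences indexed by `ℕ`, the model of `ran 𝒞⁺`. -/
abbrev SqSeq : Type := lp (fun _ : ℕ => ℂ) 2

/-- Extension by zero of a one-sided sequence. -/
def extZ (x : ℕ → ℂ) : ℤ → ℂ := fun n => if 0 ≤ n then x n.toNat else 0

@[simp]
theorem extZ_natCast (x : ℕ → ℂ) (n : ℕ) : extZ x n = x n := by simp [extZ]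

theorem extZ_of_neg (x : ℕ → ℂ) {n : ℤ} (hn : n < 0) : extZ x n = 0 := if_neg (by omega)

theorem extZ_of_nonneg (x : ℕ → ℂ) {n : ℤ} (hn : 0 ≤ n) : extZ x n = x n.toNat := if_pos hn

theorem memℓp_two_iff {x : ℕ → ℂ} : Memℓp x 2 ↔ Summable fun n => ‖x n‖ ^ 2 := by
  rw [memℓp_gen_iff (by norm_num)]
  norm_num

theorem SqSeq.hasSum_norm_sq (x : SqSeq) : HasSum (fun n => ‖x n‖ ^ 2) (‖x‖ ^ 2) := by
  have h := lp.hasSum_norm (p := 2) (by norm_num) x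
  norm_num at h
  exact h

theorem SqSeq.hasSum_norm_sq_extZ (x : SqSeq) : HasSum (fun n => ‖extZ x n‖ ^ 2) (‖x‖ ^ 2) := by
  rw [← (Nat.cast_injective (R := ℤ)).hasSum_iff]
  · simpa [Function.comp_def] using x.hasSum_norm_sq
  · intro n hn
    rw [extZ_of_neg]
    · simp
    · by_contra h
      exact hn ⟨n.toNat, by omega⟩

theorem SqSeq.summable_shift (x : SqSeq) (j : ℤ) :
    Summable fun n : ℕ => ‖extZ x (n - j)‖ ^ 2 :=
  x.hasSum_norm_sq_extZ.summable.comp_injective (i := fun n : ℕ => (n : ℤ) - j)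
    fun a b h => by simpa using h

/-- The Toeplitz operator with symbol `z ^ j`. -/
def shiftOp (j : ℤ) : SqSeq →L[ℂ] SqSeq :=
  LinearMap.mkContinuous
    { toFun := fun x => ⟨fun n => extZ x (n - j), memℓp_two_iff.2 (x.summable_shift j)⟩
      map_add' := fun x y => lp.ext <| funext fun n => by
        change extZ (⇑(x + y)) _ = extZ x _ + extZ y _
        unfold extZ
        split_ifs <;> simp
      map_smul' := fun c x => lp.ext <| funext fun n => by
        change extZ (⇑(c • x)) _ = c • extZ x _
        unfold extZ
        split_ifs <;> simp }
    1 fun x => by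
      rw [one_mul, ← sq_le_sq₀ (norm_nonneg _) (norm_nonneg _), ← (SqSeq.hasSum_norm_sq _).tsum_eq,
        ← x.hasSum_norm_sq_extZ.tsum_eq]
      exact tsum_comp_le_tsum_of_inj x.hasSum_norm_sq_extZ.summable (fun _ => sq_nonneg _)
        (i := fun n : ℕ => (n : ℤ) - j) fun a b h => by simpa using h

theorem shiftOp_apply (j : ℤ) (x : SqSeq) (n : ℕ) : shiftOp j x n = extZ x (n - j) := rfl

theorem norm_shiftOp_le (j : ℤ) : ‖shiftOp j‖ ≤ 1 :=
  LinearMap.mkContinuous_norm_le _ zero_le_one _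

theorem shiftOp_mul {i j : ℤ} (h : i ≤ 0 ∨ 0 ≤ j) : shiftOp i * shiftOp j = shiftOp (i + j) := by
  refine ContinuousLinearMap.ext fun x => lp.ext <| funext fun n => ?_
  rw [mul_apply_eq_comp, shiftOp_apply, shiftOp_apply]
  rcases lt_or_ge ((n : ℤ) - i) 0 with hn | hn
  · rw [extZ_of_neg _ hn, extZ_of_neg _ (by omega)]
  · rw [extZ_of_nonneg _ hn, shiftOp_apply, Int.toNat_of_nonneg hn, sub_sub]

theorem shiftOp_zero : shiftOp 0 = 1 :=
  ContinuousLinearMap.ext fun x => lp.ext <| funext fun n => by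
    rw [shiftOp_apply, sub_zero, extZ_natCast, one_apply_eq_self]

theorem shiftOp_natCast (n : ℕ) : shiftOp n = shiftOp 1 ^ n := by
  induction n with
  | zero => simpa using shiftOp_zero
  | succ n ih => rw [pow_succ, ← ih, shiftOp_mul (by simp)]; push_cast; rfl

theorem shiftOp_neg_natCast (n : ℕ) : shiftOp (-n) = shiftOp (-1) ^ n := by
  induction n with
  | zero => simpa using shiftOp_zero
  | succ n ih =>
    rw [pow_succ, ← ih, shiftOp_mul (by simp)]
    congr 1
    push_cast
    ring

/-- The Toeplitz operator with symbol of absolutely summable Fourier coefficients `a`. -/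
def toeplitzOp (a : ℤ → ℂ) : SqSeq →L[ℂ] SqSeq := ∑' j, a j • shiftOp j

theorem summable_norm_smul_shiftOp {a : ℤ → ℂ} (ha : Summable fun j => ‖a j‖) :
    Summable fun j => ‖a j • shiftOp j‖ := by
  refine Summable.of_nonneg_of_le (fun _ => norm_nonneg _) (fun j => ?_) ha
  rw [norm_smul]
  exact mul_le_of_le_one_right (norm_nonneg _) (norm_shiftOp_le j)

theorem toeplitzOp_apply {a : ℤ → ℂ} (ha : Summable fun j => ‖a j‖) (x : SqSeq) (n : ℕ) :
    toeplitzOp a x n = cmul a (extZ x) n := by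
  have h := (summable_norm_smul_shiftOp ha).of_norm.hasSum.mapL
    ((lp.evalCLM ℂ (fun _ : ℕ => ℂ) 2 n).comp (ContinuousLinearMap.apply ℂ SqSeq x))
  have h2 : toeplitzOp a x n = ∑' j, a j * extZ x (n - j) := h.tsum_eq.symm
  rw [h2, cmul, ← (Equiv.subLeft (n : ℤ)).tsum_eq]
  simp

theorem toeplitzOp_mul {g b : ℤ → ℂ} (hg : Summable fun j => ‖g j‖)
    (hb : Summable fun j => ‖b j‖) (hb' : ∀ n, 0 < n → b n = 0) :
    toeplitzOp b * toeplitzOp g = toeplitzOp (cmul g b) := by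
  rw [toeplitzOp, toeplitzOp, toeplitzOp, tsum_cmul_smul hg hb norm_shiftOp_le,
    tsum_mul_tsum_of_summable_norm (summable_norm_smul_shiftOp hb) (summable_norm_smul_shiftOp hg),
    ← (Equiv.prodComm ℤ ℤ).tsum_eq]
  refine tsum_congr fun p => ?_
  simp only [Equiv.prodComm_apply, Prod.fst_swap, Prod.snd_swap, smul_mul_smul_comm]
  rcases le_or_gt p.2 0 with h | h
  · rw [shiftOp_mul (Or.inl h), mul_comm, add_comm]
  · rw [hb' _ h]; simp

theorem toeplitzOp_eq_tsum_pow {a : ℤ → ℂ} (ha : ∀ n, n < 0 → a n = 0) :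
    toeplitzOp a = ∑' n : ℕ, a n • shiftOp 1 ^ n := by
  rw [toeplitzOp, ← Nat.cast_injective.tsum_eq]
  · simp only [shiftOp_natCast]
  · intro j hj
    by_contra hc
    refine hj ?_
    dsimp only
    rw [ha j, zero_smul]
    by_contra h
    exact hc ⟨j.toNat, by simp; omega⟩

theorem toeplitzOp_eq_tsum_neg_pow {b : ℤ → ℂ} (hb : ∀ n, 0 < n → b n = 0) :
    toeplitzOp b = ∑' n : ℕ, b (-n) • shiftOp (-1) ^ n := by
  have hinj : Function.Injective fun i : ℕ => -(i : ℤ) := fun i j h => by simpa using h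
  rw [toeplitzOp, ← hinj.tsum_eq]
  · simp only [shiftOp_neg_natCast]
  · intro j hj
    by_contra hc
    refine hj ?_
    dsimp only
    rw [hb j, zero_smul]
    by_contra h
    exact hc ⟨(-j).toNat, by simp; omega⟩

instance : Nontrivial SqSeq :=
  ⟨lp.single 2 0 1, 0, fun h => by
    have := congrArg (fun x : SqSeq => x 0) h
    simp at this⟩

/-- Solvability of the Riemann–Hilbert problem yields invertibility of the Toeplitz operator
together with stability of its finite sections. -/
theorem exists_toeplitzOp_inverse {g a b : ℤ → ℂ} (hg : Summable fun j => ‖g j‖)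
    (ha1 : hsumm 1 a)
    (hb1 : hsumm 1 b) (ha : ∀ n, n < 0 → a n = 0) (hb : ∀ n, 0 < n → b n = 0)
    (hb0 : b 0 = 1) (hab : cmul g b = a) (hom : TrivialHomogeneous g) (hnv : nonvanishing g) :
    (∃ T : SqSeq →L[ℂ] SqSeq, T * toeplitzOp g = 1 ∧ toeplitzOp g * T = 1) ∧
    ∃ (n₀ : ℕ) (c : ℝ), ∀ n, n₀ ≤ n → ∀ x : SqSeq, shiftOp (-n) x = 0 →
      ‖x‖ ≤ c * ‖toeplitzOp g x - shiftOp n (shiftOp (-n) (toeplitzOp g x))‖ := by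
  have hneg : Function.Injective fun i : ℕ => -(i : ℤ) := fun i j h => by simpa using h
  obtain ⟨Cp, hCp, hp1, hp2⟩ := exists_inverse_powerSeries (shiftOp 1) (norm_shiftOp_le 1)
    (fun n : ℕ => a n) (ha1.summable_norm.comp_injective Nat.cast_injective)
    fun z hz => tsum_pow_ne_zero hg ha1 hb1 ha hb hb0 hab hom hnv hz
  obtain ⟨Cm, -, hm1, hm2⟩ := exists_inverse_powerSeries (shiftOp (-1)) (norm_shiftOp_le (-1))
    (fun n : ℕ => b (-n)) (hb1.summable_norm.comp_injective hneg)
    fun z hz => tsum_neg_pow_ne_zero hg ha1 hb1 ha hb hb0 hab hom hnv hz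
  have hcomm : Commute (shiftOp (-1)) (toeplitzOp b) := by
    rw [toeplitzOp_eq_tsum_neg_pow hb]
    exact Commute.tsum_right _ fun n => ((Commute.refl _).pow_right n).smul_right _
  rw [← toeplitzOp_eq_tsum_pow ha] at hp1 hp2
  rw [← toeplitzOp_eq_tsum_neg_pow hb] at hm1 hm2
  have hA : toeplitzOp b * toeplitzOp g = toeplitzOp a := by
    rw [toeplitzOp_mul hg hb1.summable_norm hb, hab]
  refine ⟨⟨Cp * toeplitzOp b, by rw [mul_assoc, hA, hp1], ?_⟩, ?_⟩
  · have hA' : toeplitzOp g = Cm * toeplitzOp a := by rw [← hA, ← mul_assoc, hm1, one_mul]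
    rw [hA', mul_assoc, ← mul_assoc (toeplitzOp a), hp2, one_mul, hm1]
  · have hLV : shiftOp (-1) * shiftOp 1 = 1 := by
      rw [shiftOp_mul (by simp), neg_add_cancel, shiftOp_zero]
    obtain ⟨n₀, c, h⟩ := exists_finite_section_bound hLV (norm_shiftOp_le _) (norm_shiftOp_le _)
      hA hp1 hp2 hm1 hCp hcomm
    refine ⟨n₀, c, fun n hn x hx => ?_⟩
    rw [shiftOp_neg_natCast] at hx ⊢
    rw [shiftOp_natCast]
    exact h n hn x hx

theorem hnorm_zero_eq (u : ℤ → ℂ) : hnorm 0 u = √(∑' j, ‖u j‖ ^ 2) := by simp [hnorm]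

theorem hsumm_zero_extZ (x : SqSeq) : hsumm 0 (extZ x) :=
  hsumm_zero_iff.2 x.hasSum_norm_sq_extZ.summable

theorem hnorm_zero_extZ (x : SqSeq) : hnorm 0 (extZ x) = ‖x‖ := by
  rw [hnorm_zero_eq, x.hasSum_norm_sq_extZ.tsum_eq, Real.sqrt_sq (norm_nonneg _)]

theorem hnorm_zero_extZ_shift (x : SqSeq) (m : ℤ) :
    hnorm 0 (fun n => extZ x (n + m)) = ‖x‖ := by
  rw [← hnorm_zero_extZ, hnorm_zero_eq, hnorm_zero_eq]
  exact congrArg _ ((Equiv.addRight m).tsum_eq fun n => ‖extZ x n‖ ^ 2)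

theorem Cpl_extZ (x : ℕ → ℂ) : Cpl (extZ x) = extZ x := by
  funext n
  unfold Cpl extZ
  split_ifs <;> rfl

/-- The nonnegative modes of a square-summable two-sided sequence. -/
def SqSeq.restrict (v : ℤ → ℂ) (hv : hsumm 0 v) : SqSeq :=
  ⟨fun n => v n, memℓp_two_iff.2 ((hsumm_zero_iff.1 hv).comp_injective Nat.cast_injective)⟩

theorem extZ_restrict {v : ℤ → ℂ} (hv : hsumm 0 v) (hC : Cpl v = v) :
    extZ (SqSeq.restrict v hv) = v := by
  funext n
  rcases lt_or_ge n 0 with h | h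
  · rw [extZ_of_neg _ h, ← hC, Cpl, if_neg (by omega)]
  · rw [extZ_of_nonneg _ h]
    change v n.toNat = v n
    rw [Int.toNat_of_nonneg h]

theorem restrict_extZ (x : SqSeq) (h : hsumm 0 (extZ x)) : SqSeq.restrict (extZ x) h = x :=
  lp.ext <| funext fun n => extZ_natCast x n

theorem Topl_extZ {g : ℤ → ℂ} (hg : Summable fun j => ‖g j‖) (x : SqSeq) :
    Topl g (extZ x) = extZ (toeplitzOp g x) := by
  funext n
  rw [Topl, Cpl_extZ]
  rcases lt_or_ge n 0 with h | h
  · rw [extZ_of_neg _ h, Cpl, if_neg (by omega)]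
  · rw [extZ_of_nonneg _ h, Cpl, if_pos h, toeplitzOp_apply hg, Int.toNat_of_nonneg h]

theorem exists_Topl_inverse {g : ℤ → ℂ} (hg : Summable fun j => ‖g j‖) {T : SqSeq →L[ℂ] SqSeq}
    (h1 : T * toeplitzOp g = 1) (h2 : toeplitzOp g * T = 1) :
    ∃ (S : (ℤ → ℂ) → (ℤ → ℂ)) (cS : ℝ),
      (∀ f : ℤ → ℂ, hsumm 0 f → Cpl f = f →
        hsumm 0 (S f) ∧ Cpl (S f) = S f ∧ Topl g (S f) = f ∧
        hnorm 0 (S f) ≤ cS * hnorm 0 f) ∧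
      (∀ v : ℤ → ℂ, hsumm 0 v → Cpl v = v → S (Topl g v) = v) := by
  classical
  refine ⟨fun f => if hf : hsumm 0 f then extZ (T (SqSeq.restrict f hf)) else 0, ‖T‖, ?_, ?_⟩
  · intro f hf hC
    simp only [dif_pos hf]
    refine ⟨hsumm_zero_extZ _, Cpl_extZ _, ?_, ?_⟩
    · rw [Topl_extZ hg, ← mul_apply_eq_comp, h2, one_apply_eq_self,
        extZ_restrict hf hC]
    · have hn : hnorm 0 f = ‖SqSeq.restrict f hf‖ := by
        rw [← hnorm_zero_extZ, extZ_restrict hf hC]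
      rw [hnorm_zero_extZ, hn]
      exact T.le_opNorm _
  · intro v hv hC
    have e : Topl g v = extZ (toeplitzOp g (SqSeq.restrict v hv)) := by
      rw [← Topl_extZ hg, extZ_restrict hv hC]
    simp only [e, dif_pos (hsumm_zero_extZ _)]
    rw [restrict_extZ, ← mul_apply_eq_comp, h1, one_apply_eq_self,
      extZ_restrict hv hC]

theorem inPN.apply_eq_zero {N : ℕ} {w : ℤ → ℂ} (hw : inPN N w) {j : ℤ}
    (hj : ¬(-Nmin N ≤ j ∧ j ≤ Npl N)) : w j = 0 := by
  rw [← hw, projP, if_neg hj]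

theorem inPN.finite_support {N : ℕ} {w : ℤ → ℂ} (hw : inPN N w) :
    ∀ j ∉ Finset.Icc (-Nmin N) (Npl N), w j = 0 := fun j hj =>
  hw.apply_eq_zero (by simpa using hj)

theorem inPN.finite_section_bound {g : ℤ → ℂ} (hg : Summable fun j => ‖g j‖) {N : ℕ} {c : ℝ}
    (h : ∀ x : SqSeq, shiftOp (-N) x = 0 →
      ‖x‖ ≤ c * ‖toeplitzOp g x - shiftOp N (shiftOp (-N) (toeplitzOp g x))‖)
    {w : ℤ → ℂ} (hw : inPN N w) : hnorm 0 w ≤ c * hnorm 0 (projP N (cmul g w)) := by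
  have hsum : Nmin N + Npl N = N - 1 := by unfold Nmin Npl; omega
  have hfin : Summable fun j => ‖w j‖ ^ 2 := summable_of_ne_finset_zero fun j hj => by
    rw [hw.finite_support j hj, norm_zero, sq, zero_mul]
  let x : SqSeq := ⟨fun n => w (n - Nmin N), memℓp_two_iff.2 (hfin.comp_injective
    (i := fun n : ℕ => (n : ℤ) - Nmin N) fun a b h => by simpa using h)⟩
  have hx : ∀ n, extZ x n = w (n - Nmin N) := fun n => by
    rcases lt_or_ge n 0 with h | h
    · rw [extZ_of_neg _ h, hw.apply_eq_zero (by omega)]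
    · rw [extZ_of_nonneg _ h]
      change w (n.toNat - Nmin N) = _
      rw [Int.toNat_of_nonneg h]
  have hx0 : shiftOp (-N) x = 0 := lp.ext <| funext fun n => by
    rw [shiftOp_apply, hx, hw.apply_eq_zero (by omega)]
    rfl
  have hwx : w = fun n => extZ x (n + Nmin N) := funext fun n => by simp [hx]
  have hcm : ∀ n, cmul g w n = cmul g (extZ x) (n + Nmin N) := fun n => by
    rw [cmul, cmul, ← (Equiv.addRight (Nmin N)).tsum_eq fun j => g (n + Nmin N - j) * extZ x j]
    refine tsum_congr fun j => ?_
    simp [hx]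
  have hproj : projP N (cmul g w) = fun n => extZ (⇑(toeplitzOp g x -
      shiftOp N (shiftOp (-N) (toeplitzOp g x)))) (n + Nmin N) := by
    funext n
    rcases lt_or_ge (n + Nmin N) 0 with h | h
    · rw [extZ_of_neg _ h, projP, if_neg (by omega)]
    · obtain ⟨m, hm⟩ := Int.eq_ofNat_of_zero_le h
      rw [hm, extZ_natCast, lp.coeFn_sub, Pi.sub_apply, shiftOp_apply, projP, hcm, hm,
        ← toeplitzOp_apply hg]
      rcases lt_or_ge m N with h' | h'
      · rw [extZ_of_neg _ (by omega), if_pos (by omega), sub_zero]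
      · rw [extZ_of_nonneg _ (by omega), if_neg (by omega), shiftOp_apply,
          Int.toNat_of_nonneg (by omega), sub_neg_eq_add, sub_add_cancel, extZ_natCast, sub_self]
  rw [hproj, hnorm_zero_extZ_shift]
  nth_rewrite 1 [hwx]
  rw [hnorm_zero_extZ_shift]
  exact h x hx0

theorem existsUnique_finite_section {g : ℤ → ℂ} {N : ℕ}
    (h : ∀ w, inPN N w → projP N (cmul g w) = 0 → w = 0) (f : ℤ → ℂ) (hf : inPN N f) :
    ∃! w : ℤ → ℂ, inPN N w ∧ projP N (cmul g w) = f := by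
  have hidem : ∀ v, inPN N (projP N v) := fun v => by
    funext j
    unfold projP
    split_ifs <;> rfl
  have hsum : ∀ w, inPN N w → ∀ n, Summable fun j => g (n - j) * w j := fun w hw n =>
    summable_of_ne_finset_zero fun j hj => by rw [hw.finite_support j hj, mul_zero]
  have padd : ∀ v w, projP N (v + w) = projP N v + projP N w := fun v w => by
    funext j
    simp only [projP, Pi.add_apply]
    split_ifs <;> simp
  have psmul : ∀ (c : ℂ) w, projP N (c • w) = c • projP N w := fun c w => by
    funext j
    simp only [projP, Pi.smul_apply]
    split_ifs <;> simp
  let W : Submodule ℂ (ℤ → ℂ) :=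
    { carrier := {w | inPN N w}
      add_mem' := fun {v w} hv hw => (padd v w).trans (congrArg₂ _ hv hw)
      zero_mem' := by funext j; simp [projP]
      smul_mem' := fun c w hw => (psmul c w).trans (congrArg _ hw) }
  have hWfin : FiniteDimensional ℂ W := by
    let r : W →ₗ[ℂ] (Finset.Icc (-Nmin N) (Npl N) → ℂ) :=
      (LinearMap.funLeft ℂ ℂ (Subtype.val : Finset.Icc (-Nmin N) (Npl N) → ℤ)).comp W.subtype
    refine FiniteDimensional.of_injective r ((injective_iff_map_eq_zero r).2 fun w hw => ?_)
    refine Subtype.ext (funext fun j => ?_)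
    by_cases hj : j ∈ Finset.Icc (-Nmin N) (Npl N)
    · exact congrFun hw ⟨j, hj⟩
    · exact inPN.finite_support w.2 j hj
  let M : W →ₗ[ℂ] W :=
    { toFun := fun w => ⟨projP N (cmul g w), hidem _⟩
      map_add' := fun v w => Subtype.ext <| by
        change projP N (cmul g (v.1 + w.1)) = projP N (cmul g v.1) + projP N (cmul g w.1)
        rw [cmul_add (hsum v.1 v.2) (hsum w.1 w.2), padd]
      map_smul' := fun c w => Subtype.ext <| by
        change projP N (cmul g (c • w.1)) = c • projP N (cmul g w.1)
        rw [← psmul]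
        congr 1
        funext n
        simp only [cmul, Pi.smul_apply, smul_eq_mul, ← tsum_mul_left]
        exact tsum_congr fun j => by ring }
  have hinj : Function.Injective M := (injective_iff_map_eq_zero M).2 fun w hw =>
    Subtype.ext (h w.1 w.2 (congrArg Subtype.val hw))
  obtain ⟨w, hw⟩ := LinearMap.injective_iff_surjective.1 hinj ⟨f, hf⟩
  refine ⟨w.1, ⟨w.2, congrArg Subtype.val hw⟩, fun v hv => ?_⟩
  exact congrArg Subtype.val (hinj (a₁ := ⟨v, hv.1⟩) (Subtype.ext hv.2 |>.trans hw.symm))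

theorem TrivialHomogeneous.of_unique {g u : ℤ → ℂ} (hg : Summable fun j => ‖g j‖)
    (hu0 : hsumm 0 u) (hueq : Cpl u - cmul g (Cmn u) = g - one1)
    (huniq : ∀ u' : ℤ → ℂ, hsumm 0 u' → Cpl u' - cmul g (Cmn u') = g - one1 → u' = u) :
    TrivialHomogeneous g := by
  intro p q hp hq hpn hqn hpq
  have hsummable : ∀ v : ℤ → ℂ, (Summable fun j => ‖v j‖ ^ 2) →
      ∀ n, Summable fun j => g (n - j) * v j := fun v hv n => by
    have hC : ∀ j, ‖v j‖ ≤ 1 + ∑' j, ‖v j‖ ^ 2 := fun j => by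
      have := hv.le_tsum j fun _ _ => sq_nonneg _
      nlinarith [sq_nonneg (‖v j‖ - 1)]
    have hg' : Summable fun j => ‖g (n - j)‖ := (Equiv.subLeft n).summable_iff.2 hg
    refine Summable.of_norm_bounded (hg'.mul_right (1 + ∑' j, ‖v j‖ ^ 2)) fun j => ?_
    rw [norm_mul]
    exact mul_le_mul_of_nonneg_left (hC j) (norm_nonneg _)
  have hCm : Summable fun j => ‖Cmn u j‖ ^ 2 := by
    refine hsumm_zero_iff.1 (hu0.of_norm_le fun j => ?_)
    unfold Cmn
    split_ifs <;> simp
  have hpq' : hsumm 0 (p + -q) :=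
    (hsumm_zero_iff.2 hp).add (hsumm_zero_iff.2 (by simpa using hq))
  have e1 : Cpl (u + (p + -q)) = Cpl u + p := by
    funext j
    simp only [Cpl, Pi.add_apply, Pi.neg_apply]
    split_ifs with h
    · rw [hqn j h]; ring
    · rw [hpn j (by omega)]; ring
  have e2 : Cmn (u + (p + -q)) = Cmn u + q := by
    funext j
    simp only [Cmn, Pi.add_apply, Pi.neg_apply]
    split_ifs with h
    · rw [hpn j h]; ring
    · rw [hqn j (by omega)]; ring
  have h := huniq (u + (p + -q)) (hu0.add hpq') (by
    rw [e1, e2, cmul_add (hsummable _ hCm) (hsummable _ hq), hpq, ← hueq]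
    abel)
  have h0 : p + -q = 0 := by simpa using h
  funext j
  rcases lt_or_ge j 0 with hj | hj
  · have := congrFun h0 j
    simpa [hpn j hj] using this
  · exact hqn j hj

/-- **Statement 16.** (Gohberg–Feldman, via solvability of the Riemann–Hilbert problem.)
If the singular integral equation `𝒞⁺u - (𝒞⁻u)·g = g - 1` is uniquely solvable in `L²`
with solution in `H^1`, then the Toeplitz operator `𝒯(g)` is boundedly invertible on
`ran 𝒞⁺` and the finite sections `𝓜_N(g) = 𝒫_N 𝓜(g) 𝒫_N` are eventually invertible on
`ran 𝒫_N`, with uniformly bounded inverses on `L²`. -/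
theorem toeplitz_finite_sections_invertible
    (g : ℤ → ℂ) (hg : hsumm 1 g) (hnv : nonvanishing g)
    (u : ℤ → ℂ) (hu0 : hsumm 0 u) (hu1 : hsumm 1 u)
    (hueq : Cpl u - cmul g (Cmn u) = g - one1)
    (huniq : ∀ u' : ℤ → ℂ, hsumm 0 u' → Cpl u' - cmul g (Cmn u') = g - one1 → u' = u) :
    -- `𝒯(g)` is boundedly invertible on `ran 𝒞⁺` in the `L²` norm
    (∃ (S : (ℤ → ℂ) → (ℤ → ℂ)) (cS : ℝ),
      (∀ f : ℤ → ℂ, hsumm 0 f → Cpl f = f →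
        hsumm 0 (S f) ∧ Cpl (S f) = S f ∧ Topl g (S f) = f ∧
        hnorm 0 (S f) ≤ cS * hnorm 0 f) ∧
      (∀ v : ℤ → ℂ, hsumm 0 v → Cpl v = v → S (Topl g v) = v)) ∧
    -- the finite sections `𝓜_N(g)` are invertible for `N > N₀` with
    -- `sup_{N > N₀} ‖𝓜_N(g)⁻¹‖_{L²→L²} < ∞`
    (∃ (N₀ : ℕ) (cM : ℝ), ∀ N : ℕ, N₀ < N →
      (∀ f : ℤ → ℂ, inPN N f →
        ∃! w : ℤ → ℂ, inPN N w ∧ projP N (cmul g w) = f) ∧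
      (∀ w : ℤ → ℂ, inPN N w → hnorm 0 w ≤ cM * hnorm 0 (projP N (cmul g w)))) := by
  have hg1 := hg.summable_norm
  have hom := TrivialHomogeneous.of_unique hg1 hu0 hueq huniq
  have hCp : hsumm 1 (Cpl u) := hu1.of_norm_le fun j => by
    unfold Cpl
    split_ifs <;> simp
  have hCm : hsumm 1 (Cmn u) := hu1.of_norm_le fun j => by
    unfold Cmn
    split_ifs <;> simp
  have ha1 : hsumm 1 (Cpl u + one1) := hCp.add (hsumm_one1 1)
  have hb1 : hsumm 1 (Cmn u + one1) := hCm.add (hsumm_one1 1)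
  obtain ⟨C, hC⟩ := bounded_of_summable_norm hg1
  have hgone : cmul g one1 = g := funext fun n => by
    rw [cmul, tsum_eq_single 0 fun j hj => by simp [one1, hj]]
    simp [one1]
  have hab : cmul g (Cmn u + one1) = Cpl u + one1 := by
    rw [cmul_add (summable_mul_shift hC hCm.summable_norm)
      (summable_mul_shift hC (hsumm_one1 1).summable_norm), hgone]
    rw [sub_eq_iff_eq_add] at hueq
    rw [hueq]
    abel
  obtain ⟨⟨T, hT1, hT2⟩, n₀, c, hc⟩ := exists_toeplitzOp_inverse hg1 ha1 hb1
    (fun n hn => by simp [Cpl, one1, hn.ne, hn]) (fun n hn => by simp [Cmn, one1, hn.ne', hn.le])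
    (by simp [Cmn, one1]) hab hom hnv
  refine ⟨exists_Topl_inverse hg1 hT1 hT2, n₀, c, fun N hN => ?_⟩
  have hbound : ∀ w, inPN N w → hnorm 0 w ≤ c * hnorm 0 (projP N (cmul g w)) := fun w hw =>
    hw.finite_section_bound hg1 (hc N hN.le)
  refine ⟨fun f hf => existsUnique_finite_section (fun w hw hw0 => ?_) f hf, hbound⟩
  have h := hbound w hw
  have h0 : hnorm 0 (0 : ℤ → ℂ) = 0 := by simp [hnorm_zero_eq]
  rw [hw0, h0, mul_zero, hnorm_zero_eq] at h
  have hs : Summable fun j => ‖w j‖ ^ 2 := summable_of_ne_finset_zero fun j hj => by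
    rw [hw.finite_support j hj, norm_zero, sq, zero_mul]
  have h1 : ∑' j, ‖w j‖ ^ 2 = 0 :=
    le_antisymm (Real.sqrt_eq_zero'.1 (le_antisymm h (Real.sqrt_nonneg _)))
      (tsum_nonneg fun _ => sq_nonneg _)
  have h2 := (hasSum_zero_iff_of_nonneg fun j => sq_nonneg ‖w j‖).1 (h1 ▸ hs.hasSum)
  funext j
  simpa using congrFun h2 j

end
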